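/- Let F be a division ring, n ≥ 1, and d : Fin (n+1) → ℕ. For each i ∈ {1,…,n} let A_i be a d_i × d_{i−1} matrix over F, inducing the boundary map F^{d_i} → F^{d_{i−1}} on row vectors v ↦ v·A_i, and assume A_{i+1}·A_i = 0 for 1 ≤ i ≤ n−1. Then the resulting chain complex 0 → F^{d_n} → ⋯ → F^{d_0} → 0 is exact (i.e., v ↦ v·A_n is injective, v ↦ v·A_1 is surjective, and for every 1 ≤ i ≤ n−1 the kernel of v ↦ v·A_i equals the range of v ↦ v·A_{i+1}) if and only if there exist subsets I_i ⊆ {1,…,d_i} for 0 ≤ i ≤ n with I_n = ∅ and I_0 = {1,…,d_0}, such that for every i ∈ {1,…,n} one has d_i − |I_i| = |I_{i−1}| and the square submatrix B_i of A_i formed by the rows whose index is not in I_i and the columns whose index is in I_{i−1} is invertible over F. -/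

import Mathlib

open scoped Classical

theorem mcc_inv {F α β : Type*} [DivisionRing F] [Fintype α] [Fintype β]
    [DecidableEq α] [DecidableEq β]
    (M : Matrix α β F) (hi : ∀ v : α → F, Matrix.vecMul v M = 0 → v = 0)
    (hs : ∀ y : β → F, ∃ v : α → F, Matrix.vecMul v M = y) :
    ∃ N : Matrix β α F, M * N = 1 ∧ N * M = 1 := by
  choose g hg using hs
  let N : Matrix β α F := fun j => g (Pi.single j 1)
  have hN : N * M = 1 := by
    ext i j
    have := congrFun (hg (Pi.single i 1)) j
    rw [Matrix.one_eq_pi_single, ← this]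
    rfl
  refine ⟨N, ?_, hN⟩
  have h0 : (M * N - 1) * M = 0 := by
    rw [Matrix.sub_mul, Matrix.mul_assoc, hN, Matrix.mul_one, Matrix.one_mul, sub_self]
  have : M * N - 1 = 0 := by
    funext i
    apply hi
    funext j
    exact congrFun (congrFun h0 i) j
  exact sub_eq_zero.mp this

theorem mcc_vecMul_sum {F α β : Type*} [DivisionRing F] [Fintype α]
    (M : Matrix α β F) (v : α → F) : Matrix.vecMul v M = ∑ i, v i • M i := by
  funext j
  simp [Matrix.vecMul, dotProduct]

theorem mcc_basis {F α β : Type*} [DivisionRing F] [Fintype α] [Fintype β]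
    [DecidableEq α] [DecidableEq β]
    (M : Matrix α β F) (hs : ∀ y : β → F, ∃ v : α → F, Matrix.vecMul v M = y) :
    ∃ I : Finset α, ∃ N : Matrix β {x : α // x ∉ I} F,
      M.submatrix (fun x : {x : α // x ∉ I} => x.1) id * N = 1 ∧
      N * M.submatrix (fun x : {x : α // x ∉ I} => x.1) id = 1 := by
  obtain ⟨κ, a, ha, hsp, hli⟩ := exists_linearIndependent' F (fun x : α => (M x : β → F))
  let I : Finset α := Finset.univ.filter (fun x => x ∉ Set.range a)
  have hI : ∀ x, x ∉ I ↔ x ∈ Set.range a := by intro x; simp [I]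
  refine ⟨I, mcc_inv _ ?_ ?_⟩
  · have h2 : LinearIndependent F (fun x : {x : α // x ∉ I} => (M x.1 : β → F)) := by
      have hc : ∀ x : {x : α // x ∉ I}, ∃ k, a k = x.1 := fun x => (hI x.1).1 x.2
      choose c hc using hc
      have hcinj : Function.Injective c := by
        intro x y h
        apply Subtype.ext
        rw [← hc x, ← hc y, h]
      have := hli.comp c hcinj
      have heq : (((fun x : α => (M x : β → F)) ∘ a) ∘ c) =
          (fun x : {x : α // x ∉ I} => (M x.1 : β → F)) := by
        funext x
        simp only [Function.comp_apply, hc]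
      rw [heq] at this
      exact this
    intro v hv
    rw [mcc_vecMul_sum] at hv
    funext x
    exact Fintype.linearIndependent_iff.1 h2 v hv x
  · intro y
    have htop : y ∈ Submodule.span F (Set.range (fun x : α => (M x : β → F))) := by
      obtain ⟨v, rfl⟩ := hs y
      rw [mcc_vecMul_sum]
      exact Submodule.sum_mem _ fun i _ => Submodule.smul_mem _ _ (Submodule.subset_span ⟨i, rfl⟩)
    rw [← hsp] at htop
    have hsub : Set.range ((fun x : α => (M x : β → F)) ∘ a) ⊆
        Set.range (fun x : {x : α // x ∉ I} => (M x.1 : β → F)) := by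
      rintro _ ⟨k, rfl⟩
      exact ⟨⟨a k, (hI _).2 ⟨k, rfl⟩⟩, rfl⟩
    obtain ⟨v, hv⟩ := (Submodule.mem_span_range_iff_exists_fun F).1 (Submodule.span_mono hsub htop)
    refine ⟨v, ?_⟩
    rw [mcc_vecMul_sum, ← hv]
    rfl

/-- Invertibility of the submatrix with rows outside `I'` and columns in `I`. -/
def mccInv {F α β : Type*} [DivisionRing F] [Fintype α] [Fintype β]
    [DecidableEq α] [DecidableEq β]
    (M : Matrix α β F) (I : Finset β) (I' : Finset α) : Prop :=
  ∃ N : Matrix {y : β // y ∈ I} {x : α // x ∉ I'} F,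
    M.submatrix (fun x : {x : α // x ∉ I'} => x.1) (fun y : {y : β // y ∈ I} => y.1) * N = 1 ∧
    N * M.submatrix (fun x : {x : α // x ∉ I'} => x.1) (fun y : {y : β // y ∈ I} => y.1) = 1

theorem mcc_step {F α β : Type*} [DivisionRing F] [Fintype α] [Fintype β]
    [DecidableEq α] [DecidableEq β]
    (M : Matrix α β F) (I : Finset β)
    (hs : ∀ y : β → F, ∃ v : α → F, ∀ j ∈ I, Matrix.vecMul v M j = y j) :
    ∃ I' : Finset α, mccInv M I I' := by
  obtain ⟨I', N, h1, h2⟩ := mcc_basis (M.submatrix id (fun y : {y : β // y ∈ I} => y.1)) (by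
    intro y
    obtain ⟨v, hv⟩ := hs (fun j => if h : j ∈ I then y ⟨j, h⟩ else 0)
    refine ⟨v, ?_⟩
    funext j
    have := hv j.1 j.2
    rw [dif_pos j.2] at this
    exact this)
  exact ⟨I', N, h1, h2⟩

theorem mcc_card {F α β : Type*} [DivisionRing F] [Fintype α] [Fintype β]
    [DecidableEq α] [DecidableEq β]
    {M : Matrix α β F} {I : Finset β} {I' : Finset α} (h : mccInv M I I') :
    Fintype.card α - I'.card = I.card := by
  obtain ⟨N, h1, h2⟩ := h
  have := Matrix.square_of_invertible _ _ h1 h2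
  rw [Fintype.card_subtype_compl, Fintype.card_coe, Fintype.card_coe] at this
  exact this

theorem mcc_sum {F α β : Type*} [DivisionRing F] [Fintype α] [Fintype β]
    [DecidableEq α] [DecidableEq β]
    (M : Matrix α β F) (I' : Finset α) (v : α → F) (hv : ∀ x ∈ I', v x = 0) (j : β) :
    Matrix.vecMul v M j = ∑ x : {x : α // x ∉ I'}, v x.1 * M x.1 j := by
  simp only [Matrix.vecMul, dotProduct]
  rw [← Finset.sum_subtype (p := fun x => x ∉ I') (Finset.univ.filter (fun x => x ∉ I'))
    (by simp) (fun x => v x * M x j)]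
  rw [Finset.sum_filter]
  apply Finset.sum_congr rfl
  intro x _
  by_cases h : x ∈ I'
  · simp [h, hv x h]
  · simp [h]

theorem mcc_inj {F α β : Type*} [DivisionRing F] [Fintype α] [Fintype β]
    [DecidableEq α] [DecidableEq β]
    {M : Matrix α β F} {I : Finset β} {I' : Finset α} (h : mccInv M I I')
    (v : α → F) (hv : ∀ x ∈ I', v x = 0) (h0 : ∀ j ∈ I, Matrix.vecMul v M j = 0) : v = 0 := by
  obtain ⟨N, h1, h2⟩ := h
  have h3 : Matrix.vecMul (fun x : {x : α // x ∉ I'} => v x.1)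
      (M.submatrix (fun x : {x : α // x ∉ I'} => x.1) (fun y : {y : β // y ∈ I} => y.1)) = 0 := by
    funext j
    have := h0 j.1 j.2
    rw [mcc_sum M I' v hv] at this
    exact this
  have h4 := congrArg (fun w => Matrix.vecMul w N) h3
  simp only [Matrix.vecMul_vecMul, h1, Matrix.vecMul_one, Matrix.zero_vecMul] at h4
  funext x
  by_cases h : x ∈ I'
  · exact hv x h
  · exact congrFun h4 ⟨x, h⟩

theorem mcc_surj {F α β : Type*} [DivisionRing F] [Fintype α] [Fintype β]
    [DecidableEq α] [DecidableEq β]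
    {M : Matrix α β F} {I : Finset β} {I' : Finset α} (h : mccInv M I I') (y : β → F) :
    ∃ v : α → F, (∀ x ∈ I', v x = 0) ∧ ∀ j ∈ I, Matrix.vecMul v M j = y j := by
  obtain ⟨N, h1, h2⟩ := h
  let u := Matrix.vecMul (fun j : {y : β // y ∈ I} => y j.1) N
  have hu : Matrix.vecMul u (M.submatrix (fun x : {x : α // x ∉ I'} => x.1)
      (fun y : {y : β // y ∈ I} => y.1)) = (fun j : {y : β // y ∈ I} => y j.1) := by
    simp only [u, Matrix.vecMul_vecMul, h2, Matrix.vecMul_one]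
  have hz : ∀ x ∈ I', (fun x => if h : x ∉ I' then u ⟨x, h⟩ else 0) x = 0 := by
    intro x hx
    simp [hx]
  refine ⟨fun x => if h : x ∉ I' then u ⟨x, h⟩ else 0, hz, ?_⟩
  intro j hj
  rw [mcc_sum M I' _ hz, ← congrFun hu ⟨j, hj⟩]
  simp only [Matrix.vecMul, dotProduct, Matrix.submatrix_apply]
  apply Finset.sum_congr rfl
  intro x _
  rw [dif_pos x.2]

/-- Turaev's matrix chain criterion for exactness of a finite based free
chain complex over a division ring.  The chain complex
`0 → F^{d n} → ⋯ → F^{d 0} → 0` is given by matrices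
`A i : Matrix (Fin (d (i+1))) (Fin (d i)) F` (inducing `v ↦ v ᵥ* A i` on
row vectors), satisfying `A (i+1) * A i = 0` for `i + 2 ≤ n`. -/
theorem matrix_chain_criterion (F : Type*) [DivisionRing F] (n : ℕ) (hn : 1 ≤ n)
    (d : ℕ → ℕ) (A : ∀ i : ℕ, Matrix (Fin (d (i + 1))) (Fin (d i)) F)
    (hA : ∀ i : ℕ, i + 2 ≤ n → A (i + 1) * A i = 0) :
    ((∀ i : ℕ, i + 1 = n →
        Function.Injective fun v : Fin (d (i + 1)) → F => Matrix.vecMul v (A i)) ∧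
      (Function.Surjective fun v : Fin (d 1) → F => Matrix.vecMul v (A 0)) ∧
      (∀ i : ℕ, i + 2 ≤ n →
        {v : Fin (d (i + 1)) → F | Matrix.vecMul v (A i) = 0} =
          Set.range fun w : Fin (d (i + 2)) → F => Matrix.vecMul w (A (i + 1))))
    ↔
    (∃ I : ∀ i : ℕ, Finset (Fin (d i)),
      I n = ∅ ∧ I 0 = Finset.univ ∧
      ∀ i : ℕ, i < n →
        (d (i + 1) - (I (i + 1)).card = (I i).card) ∧
        ∃ N : Matrix {y : Fin (d i) // y ∈ I i} {x : Fin (d (i + 1)) // x ∉ I (i + 1)} F,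
          (A i).submatrix (fun x : {x : Fin (d (i + 1)) // x ∉ I (i + 1)} => x.1)
              (fun y : {y : Fin (d i) // y ∈ I i} => y.1) * N = 1 ∧
          N * (A i).submatrix (fun x : {x : Fin (d (i + 1)) // x ∉ I (i + 1)} => x.1)
              (fun y : {y : Fin (d i) // y ∈ I i} => y.1) = 1) := by
  constructor
  · rintro ⟨hinj, hsur, hex⟩
    have hstep : ∀ (i : ℕ) (I : Finset (Fin (d i))), ∃ I' : Finset (Fin (d (i + 1))),
        (∀ y : Fin (d i) → F, ∃ v, ∀ j ∈ I, Matrix.vecMul v (A i) j = y j) →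
          mccInv (A i) I I' := by
      intro i I
      by_cases hs : ∀ y : Fin (d i) → F, ∃ v, ∀ j ∈ I, Matrix.vecMul v (A i) j = y j
      · obtain ⟨I', h⟩ := mcc_step (A i) I hs
        exact ⟨I', fun _ => h⟩
      · exact ⟨∅, fun h => absurd h hs⟩
    choose s hs using hstep
    let I : ∀ i : ℕ, Finset (Fin (d i)) := fun i => Nat.rec Finset.univ (fun i J => s i J) i
    have hI : ∀ i, I (i + 1) = s i (I i) := fun i => rfl
    have key : ∀ i, i < n →
        (∀ v, (∀ j ∈ I i, Matrix.vecMul v (A i) j = 0) → Matrix.vecMul v (A i) = 0) ∧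
        mccInv (A i) (I i) (I (i + 1)) := by
      intro i
      induction i with
      | zero =>
        intro _
        refine ⟨fun v hv => funext fun j => hv j (Finset.mem_univ j), ?_⟩
        rw [hI]
        apply hs
        intro y
        obtain ⟨v, hv⟩ := hsur y
        exact ⟨v, fun j _ => congrFun hv j⟩
      | succ i ih =>
        intro hi
        obtain ⟨hk, hB⟩ := ih (by omega)
        have hex' := Set.ext_iff.1 (hex i (by omega))
        refine ⟨?_, ?_⟩
        · intro v hv
          apply mcc_inj hB _ hv
          intro j _
          exact congrFun ((hex' _).2 ⟨v, rfl⟩) j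
        · rw [hI (i + 1)]
          apply hs
          intro y
          let y' : Fin (d (i + 1)) → F := fun j => if j ∈ I (i + 1) then y j else 0
          obtain ⟨w, hw0, hw⟩ := mcc_surj hB (Matrix.vecMul y' (A i))
          have hker : Matrix.vecMul (y' - w) (A i) = 0 := by
            apply hk
            intro j hj
            rw [Matrix.sub_vecMul, Pi.sub_apply, hw j hj, sub_self]
          obtain ⟨v, hv⟩ := (hex' _).1 hker
          refine ⟨v, fun j hj => ?_⟩
          have := congrFun hv j
          simp only [Pi.sub_apply, hw0 j hj, sub_zero, y', if_pos hj] at this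
          exact this
    refine ⟨I, ?_, rfl, ?_⟩
    · obtain ⟨m, rfl⟩ : ∃ m, n = m + 1 := ⟨n - 1, by omega⟩
      obtain ⟨hk, hB⟩ := key m (by omega)
      rw [Finset.eq_empty_iff_forall_notMem]
      intro x hx
      let e : Fin (d (m + 1)) → F := Pi.single x 1
      obtain ⟨w, hw0, hw⟩ := mcc_surj hB (Matrix.vecMul e (A m))
      have hker : Matrix.vecMul (e - w) (A m) = 0 := by
        apply hk
        intro j hj
        rw [Matrix.sub_vecMul, Pi.sub_apply, hw j hj, sub_self]
      have h0 : e - w = 0 := hinj m rfl (by simpa using hker)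
      have := congrFun h0 x
      simp [e, hw0 x hx] at this
    · intro i hi
      obtain ⟨_, hB⟩ := key i hi
      refine ⟨?_, hB⟩
      simpa using mcc_card hB
  · rintro ⟨I, hIn, hI0, h⟩
    have hB : ∀ i, i < n → mccInv (A i) (I i) (I (i + 1)) := fun i hi => (h i hi).2
    refine ⟨?_, ?_, ?_⟩
    · rintro i rfl v w hvw
      have hvw' : Matrix.vecMul v (A i) = Matrix.vecMul w (A i) := hvw
      rw [← sub_eq_zero]
      apply mcc_inj (hB i (by omega))
      · intro x hx
        rw [hIn] at hx
        simp at hx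
      · intro j _
        rw [Matrix.sub_vecMul, hvw', sub_self, Pi.zero_apply]
    · intro y
      obtain ⟨v, _, hv⟩ := mcc_surj (hB 0 (by omega)) y
      exact ⟨v, funext fun j => hv j (by rw [hI0]; exact Finset.mem_univ j)⟩
    · intro i hi
      ext v
      constructor
      · intro hv
        have hv' : Matrix.vecMul v (A i) = 0 := hv
        obtain ⟨w, _, hw⟩ := mcc_surj (hB (i + 1) (by omega)) v
        refine ⟨w, ?_⟩
        change Matrix.vecMul w (A (i + 1)) = v
        rw [← sub_eq_zero]
        apply mcc_inj (hB i (by omega))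
        · intro x hx
          rw [Pi.sub_apply, hw x hx, sub_self]
        · intro j _
          rw [Matrix.sub_vecMul, hv', Matrix.vecMul_vecMul, hA i hi, Matrix.vecMul_zero, sub_self,
            Pi.zero_apply]
      · rintro ⟨w, rfl⟩
        change Matrix.vecMul (Matrix.vecMul w (A (i + 1))) (A i) = 0
        rw [Matrix.vecMul_vecMul, hA i hi, Matrix.vecMul_zero]
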